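/- arXiv:2309.05328 — 2 statements merged into one kernel-verified Lean document; each statement's English description precedes it below -/
import Mathlib

section
/- Let m, L ≥ 1 be natural numbers, p ≥ 2 and T > 0 real numbers, ε ∈ (0,1), and let u : ℝ^m × (0,T) → ℝ^L be a smooth solution of the regularized p-harmonic flow with flat target, i.e. ∂_t u = Σ_{i=1}^m ∂_i (F^{(p−2)/2} ∂_i u) where F = ε + Σ_{i=1}^m ‖∂_i u‖². Then the following Bochner-type identity holds pointwise on ℝ^m × (0,T): ∂_t F − Σ_{j} ∂_j (F^{(p−2)/2} ∂_j F) = (p−2) Σ_{j} ∂_j ( F^{(p−4)/2} Σ_{i} ⟨∂_i u, ∂_j u⟩ ∂_i F ) − 2 F^{(p−2)/2} Σ_{i,j} ‖∂_i ∂_j u‖² − ((p−2)/2) F^{(p−4)/2} Σ_{i} (∂_i F)². -/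
open scoped RealInnerProductSpace
open Set

/-- The partial derivative of a map on `ℝ^m` in the `i`-th coordinate direction. -/
noncomputable def pd {m : ℕ} {G : Type*} [NormedAddCommGroup G] [NormedSpace ℝ G]
    (v : EuclideanSpace ℝ (Fin m) → G) (i : Fin m) (x : EuclideanSpace ℝ (Fin m)) : G :=
  fderiv ℝ v x (EuclideanSpace.single i 1)

section PartialDerivatives

theorem minSmoothness_two_le_top : minSmoothness ℝ 2 ≤ ((⊤ : ℕ∞) : WithTop ℕ∞) := by
  rw [minSmoothness_of_isRCLikeNormedField]
  exact WithTop.coe_le_coe.2 (le_top (a := (2 : ℕ∞)))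

variable {m : ℕ} {G : Type*} [NormedAddCommGroup G]

theorem contDiff_pd [NormedSpace ℝ G] {v : EuclideanSpace ℝ (Fin m) → G}
    (hv : ContDiff ℝ (⊤ : ℕ∞) v) (i : Fin m) : ContDiff ℝ (⊤ : ℕ∞) (pd v i) :=
  (hv.fderiv_right (m := (⊤ : ℕ∞)) (by norm_cast)).clm_apply contDiff_const

theorem pd_add [NormedSpace ℝ G] {v w : EuclideanSpace ℝ (Fin m) → G}
    {x : EuclideanSpace ℝ (Fin m)}
    (hv : DifferentiableAt ℝ v x) (hw : DifferentiableAt ℝ w x) (i : Fin m) :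
    pd (fun y => v y + w y) i x = pd v i x + pd w i x := by
  simp [pd, fderiv_fun_add hv hw]

theorem pd_sum [NormedSpace ℝ G] {ι : Type*} (s : Finset ι)
    {v : ι → EuclideanSpace ℝ (Fin m) → G} {x : EuclideanSpace ℝ (Fin m)}
    (hv : ∀ k ∈ s, DifferentiableAt ℝ (v k) x) (i : Fin m) :
    pd (fun y => ∑ k ∈ s, v k y) i x = ∑ k ∈ s, pd (v k) i x := by
  simp [pd, fderiv_fun_sum hv]

theorem pd_const_mul {f : EuclideanSpace ℝ (Fin m) → ℝ} {x : EuclideanSpace ℝ (Fin m)}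
    (hf : DifferentiableAt ℝ f x) (c : ℝ) (i : Fin m) :
    pd (fun y => c * f y) i x = c * pd f i x := by
  simp [pd, fderiv_const_mul hf]

theorem pd_smul [NormedSpace ℝ G] {f : EuclideanSpace ℝ (Fin m) → ℝ}
    {v : EuclideanSpace ℝ (Fin m) → G} {x : EuclideanSpace ℝ (Fin m)}
    (hf : DifferentiableAt ℝ f x) (hv : DifferentiableAt ℝ v x) (i : Fin m) :
    pd (fun y => f y • v y) i x = f x • pd v i x + pd f i x • v x := by
  simp [pd, fderiv_fun_smul hf hv]

theorem pd_rpow_const {f : EuclideanSpace ℝ (Fin m) → ℝ} {x : EuclideanSpace ℝ (Fin m)}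
    (hf : DifferentiableAt ℝ f x) (hx : f x ≠ 0) (r : ℝ) (i : Fin m) :
    pd (fun y => f y ^ r) i x = r * f x ^ (r - 1) * pd f i x := by
  simp [pd, (hf.hasFDerivAt.rpow_const (p := r) (Or.inl hx)).fderiv]

theorem pd_inner [InnerProductSpace ℝ G] {v w : EuclideanSpace ℝ (Fin m) → G}
    {x : EuclideanSpace ℝ (Fin m)}
    (hv : DifferentiableAt ℝ v x) (hw : DifferentiableAt ℝ w x) (i : Fin m) :
    pd (fun y => ⟪v y, w y⟫) i x = ⟪v x, pd w i x⟫ + ⟪pd v i x, w x⟫ := by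
  simp [pd, fderiv_inner_apply ℝ hv hw]

theorem pd_comm [NormedSpace ℝ G] {v : EuclideanSpace ℝ (Fin m) → G}
    (hv : ContDiff ℝ (⊤ : ℕ∞) v) (i j : Fin m) (x : EuclideanSpace ℝ (Fin m)) :
    pd (pd v i) j x = pd (pd v j) i x := by
  have hd : DifferentiableAt ℝ (fderiv ℝ v) x :=
    (hv.fderiv_right (m := (⊤ : ℕ∞)) (by norm_cast)).contDiffAt.differentiableAt (by simp)
  have hpd : ∀ k l, pd (pd v k) l x =
      fderiv ℝ (fderiv ℝ v) x (EuclideanSpace.single l 1) (EuclideanSpace.single k 1) := by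
    intro k l
    change fderiv ℝ (fun y => fderiv ℝ v y (EuclideanSpace.single k 1)) x _ = _
    simp [fderiv_clm_apply hd (differentiableAt_const _)]
  rw [hpd, hpd]
  exact (hv.contDiffAt.isSymmSndFDerivAt minSmoothness_two_le_top).eq _ _

/-- The time derivative and a spatial partial derivative of a smooth map commute. -/
theorem hasDerivAt_pd [NormedSpace ℝ G] {u : ℝ → EuclideanSpace ℝ (Fin m) → G} {I : Set ℝ}
    (hI : IsOpen I)
    (hu : ContDiffOn ℝ (⊤ : ℕ∞) (fun q : ℝ × EuclideanSpace ℝ (Fin m) => u q.1 q.2)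
      (I ×ˢ univ)) {t : ℝ} (ht : t ∈ I) (x : EuclideanSpace ℝ (Fin m)) (k : Fin m) :
    HasDerivAt (fun s => pd (u s) k x) (pd (fun y => deriv (fun s => u s y) t) k x) t := by
  set U := fun q : ℝ × EuclideanSpace ℝ (Fin m) => u q.1 q.2 with hU
  have hsmooth : ∀ s ∈ I, ∀ y, ContDiffAt ℝ (⊤ : ℕ∞) U (s, y) := fun s hs y =>
    hu.contDiffAt ((hI.prod isOpen_univ).mem_nhds ⟨hs, mem_univ y⟩)
  have hspace : ∀ s ∈ I, ∀ y, pd (u s) k y =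
      fderiv ℝ U (s, y) (0, EuclideanSpace.single k 1) := by
    intro s hs y
    have h := (((hsmooth s hs y).differentiableAt (by simp)).hasFDerivAt).comp y
      (hasFDerivAt_prodMk_right s y)
    change fderiv ℝ (U ∘ fun z => (s, z)) y _ = _
    rw [h.fderiv]
    simp
  have hline : ∀ y : EuclideanSpace ℝ (Fin m),
      HasDerivAt (fun s : ℝ => (s, y)) ((1 : ℝ), (0 : EuclideanSpace ℝ (Fin m))) t :=
    fun y => (hasDerivAt_id t).prodMk (hasDerivAt_const t y)
  have htime : ∀ y, deriv (fun s => u s y) t = fderiv ℝ U (t, y) (1, 0) := by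
    intro y
    exact (((hsmooth t ht y).differentiableAt (by simp)).hasFDerivAt.comp_hasDerivAt t
      (hline y)).deriv
  have hd : HasFDerivAt (fderiv ℝ U) (fderiv ℝ (fderiv ℝ U) (t, x)) (t, x) :=
    (((hsmooth t ht x).fderiv_right (m := (⊤ : ℕ∞)) (by norm_cast)).differentiableAt
      (by simp)).hasFDerivAt
  have hsymm := ((hsmooth t ht x).isSymmSndFDerivAt minSmoothness_two_le_top).eq
    (1, 0) (0, EuclideanSpace.single k 1)
  have hdt : HasDerivAt (fun s => fderiv ℝ U (s, x))
      (fderiv ℝ (fderiv ℝ U) (t, x) (1, 0)) t := hd.comp_hasDerivAt t (hline x)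
  have hdx : HasFDerivAt (fun y => fderiv ℝ U (t, y))
      ((fderiv ℝ (fderiv ℝ U) (t, x)).comp (.inr ℝ ℝ _)) x :=
    hd.comp x (hasFDerivAt_prodMk_right t x)
  have hmixed : pd (fun y => deriv (fun s => u s y) t) k x =
      fderiv ℝ (fderiv ℝ U) (t, x) (1, 0) (0, EuclideanSpace.single k 1) := by
    rw [hsymm, pd, funext htime, fderiv_clm_apply hdx.differentiableAt (differentiableAt_const _),
      hdx.fderiv]
    simp
  rw [hmixed]
  have h := hdt.clm_apply (hasDerivAt_const t ((0 : ℝ), EuclideanSpace.single k (1 : ℝ)))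
  rw [map_zero, add_zero] at h
  exact h.congr_of_eventuallyEq <| by
    filter_upwards [hI.mem_nhds ht] with s hs using hspace s hs x

end PartialDerivatives

/-- The Bochner identity at a fixed time, with `∂_t ∂_k u` replaced by the `k`-th derivative of the
regularized `p`-Laplacian. -/
theorem bochner_identity_fixed_time {m : ℕ} {G : Type*} [NormedAddCommGroup G]
    [InnerProductSpace ℝ G] (p ε : ℝ) (hε : 0 < ε) {v : EuclideanSpace ℝ (Fin m) → G}
    (hv : ContDiff ℝ (⊤ : ℕ∞) v) {f : EuclideanSpace ℝ (Fin m) → ℝ}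
    (hf : ∀ x, f x = ε + ∑ i, ‖pd v i x‖ ^ 2) (x : EuclideanSpace ℝ (Fin m)) :
    (∑ k, 2 * ⟪pd v k x,
        pd (fun y => ∑ i, pd (fun z => f z ^ ((p - 2) / 2) • pd v i z) i y) k x⟫)
      - (∑ j, pd (fun y => f y ^ ((p - 2) / 2) * pd f j y) j x)
      = (p - 2) * (∑ j, pd (fun y => f y ^ ((p - 4) / 2)
            * ∑ i, ⟪pd v i y, pd v j y⟫ * pd f i y) j x)
        - 2 * f x ^ ((p - 2) / 2) * (∑ i, ∑ j, ‖pd (fun y => pd v j y) i x‖ ^ 2)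
        - ((p - 2) / 2) * f x ^ ((p - 4) / 2) * (∑ i, (pd f i x) ^ 2) := by
  have hD : ∀ {g : EuclideanSpace ℝ (Fin m) → G}, ContDiff ℝ (⊤ : ℕ∞) g →
      ∀ y, DifferentiableAt ℝ g y := fun hg y => hg.contDiffAt.differentiableAt (by simp)
  have hDr : ∀ {g : EuclideanSpace ℝ (Fin m) → ℝ}, ContDiff ℝ (⊤ : ℕ∞) g →
      ∀ y, DifferentiableAt ℝ g y := fun hg y => hg.contDiffAt.differentiableAt (by simp)
  have hpv := contDiff_pd hv
  have hfpos : ∀ y, 0 < f y := fun y => by rw [hf]; positivity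
  have hfsmooth : ContDiff ℝ (⊤ : ℕ∞) f := by
    rw [funext hf]
    exact contDiff_const.add (ContDiff.sum fun i _ => (hpv i).norm_sq ℝ)
  have hpow : ∀ r : ℝ, ContDiff ℝ (⊤ : ℕ∞) fun y => f y ^ r := fun r =>
    hfsmooth.rpow_const_of_ne fun y => (hfpos y).ne'
  have hpf := contDiff_pd hfsmooth
  have hpdf : ∀ i y, pd f i y = ∑ k, 2 * ⟪pd v k y, pd (pd v k) i y⟫ := by
    intro i y
    have hadd := pd_add (differentiableAt_const ε)
      (hDr (ContDiff.sum (s := Finset.univ) fun k _ => (hpv k).inner ℝ (hpv k)) y) i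
    rw [pd_sum _ fun k _ => hDr ((hpv k).inner ℝ (hpv k)) y] at hadd
    rw [funext hf]
    simp only [← real_inner_self_eq_norm_sq]
    rw [hadd]
    simp only [pd_inner (hD (hpv _) y) (hD (hpv _) y)]
    simp [pd, real_inner_comm, two_mul]
  have hexp : (p - 2) / 2 - 1 = (p - 4) / 2 := by ring
  have hpda : ∀ k y, pd (fun z => f z ^ ((p - 2) / 2)) k y =
      (p - 2) / 2 * f y ^ ((p - 4) / 2) * pd f k y := fun k y => by
    rw [pd_rpow_const (hDr hfsmooth y) (hfpos y).ne', hexp]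
  have hW : ∀ i, ContDiff ℝ (⊤ : ℕ∞) fun z => f z ^ ((p - 2) / 2) • pd v i z := fun i =>
    (hpow _).smul (hpv i)
  have hpW : ∀ i k y, pd (fun z => f z ^ ((p - 2) / 2) • pd v i z) k y =
      f y ^ ((p - 2) / 2) • pd (pd v k) i y
        + ((p - 2) / 2 * f y ^ ((p - 4) / 2) * pd f k y) • pd v i y := fun i k y => by
    rw [pd_smul (hDr (hpow _) y) (hD (hpv i) y), hpda, pd_comm hv]
  have hflux : ∀ i y, ∑ k, 2 * ⟪pd v k y, pd (fun z => f z ^ ((p - 2) / 2) • pd v i z) k y⟫ =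
      f y ^ ((p - 2) / 2) * pd f i y
        + (p - 2) * (f y ^ ((p - 4) / 2) * ∑ k, ⟪pd v k y, pd v i y⟫ * pd f k y) := by
    intro i y
    rw [hpdf i y]
    simp only [Finset.mul_sum, ← Finset.sum_add_distrib, hpW, inner_add_right,
      real_inner_smul_right]
    exact Finset.sum_congr rfl fun k _ => by ring
  have hdiv : ∀ i, (∑ k, 2 * ⟪pd v k x,
        pd (pd (fun z => f z ^ ((p - 2) / 2) • pd v i z) i) k x⟫) =
      pd (fun y => f y ^ ((p - 2) / 2) * pd f i y) i x
        + (p - 2) * pd (fun y => f y ^ ((p - 4) / 2) * ∑ k, ⟪pd v k y, pd v i y⟫ * pd f k y) i x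
        - ∑ k, 2 * ⟪pd (pd v k) i x, pd (fun z => f z ^ ((p - 2) / 2) • pd v i z) k x⟫ := by
    intro i
    have hin : ∀ k, ContDiff ℝ (⊤ : ℕ∞) fun y =>
        ⟪pd v k y, pd (fun z => f z ^ ((p - 2) / 2) • pd v i z) k y⟫ := fun k =>
      (hpv k).inner ℝ (contDiff_pd (hW i) k)
    have hsmooth : ContDiff ℝ (⊤ : ℕ∞) fun y =>
        f y ^ ((p - 4) / 2) * ∑ k, ⟪pd v k y, pd v i y⟫ * pd f k y :=
      (hpow _).mul (ContDiff.sum fun k _ => ((hpv k).inner ℝ (hpv i)).mul (hpf k))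
    rw [← pd_const_mul (hDr hsmooth x),
      ← pd_add (hDr ((hpow _).mul (hpf i)) x) (hDr (contDiff_const.mul hsmooth) x),
      ← funext (hflux i), pd_sum _ fun k _ => hDr (contDiff_const.mul (hin k)) x,
      ← Finset.sum_sub_distrib]
    refine Finset.sum_congr rfl fun k _ => ?_
    rw [pd_const_mul (hDr (hin k) x), pd_inner (hD (hpv k) x) (hD (contDiff_pd (hW i) k) x),
      pd_comm (hW i)]
    ring
  have hrem : ∑ i, ∑ k, 2 * ⟪pd (pd v k) i x,
        pd (fun z => f z ^ ((p - 2) / 2) • pd v i z) k x⟫ =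
      2 * f x ^ ((p - 2) / 2) * (∑ i, ∑ j, ‖pd (fun y => pd v j y) i x‖ ^ 2)
        + (p - 2) / 2 * f x ^ ((p - 4) / 2) * ∑ i, pd f i x ^ 2 := by
    have hsq : ∑ k, pd f k x ^ 2 =
        ∑ i, ∑ k, 2 * ⟪pd (pd v k) i x, pd v i x⟫ * pd f k x := by
      rw [Finset.sum_comm]
      refine Finset.sum_congr rfl fun k _ => ?_
      rw [← Finset.sum_mul, sq]
      congr 1
      rw [hpdf]
      exact Finset.sum_congr rfl fun i _ => by rw [real_inner_comm, pd_comm hv]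
    rw [hsq]
    simp only [Finset.mul_sum, ← Finset.sum_add_distrib, hpW, inner_add_right,
      real_inner_smul_right, real_inner_self_eq_norm_sq]
    exact Finset.sum_congr rfl fun i _ => Finset.sum_congr rfl fun k _ => by ring
  have hlhs : (∑ k, 2 * ⟪pd v k x,
        pd (fun y => ∑ i, pd (fun z => f z ^ ((p - 2) / 2) • pd v i z) i y) k x⟫) =
      ∑ i, ∑ k, 2 * ⟪pd v k x, pd (pd (fun z => f z ^ ((p - 2) / 2) • pd v i z) i) k x⟫ := by
    rw [Finset.sum_comm]
    refine Finset.sum_congr rfl fun k _ => ?_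
    rw [pd_sum _ fun i _ => hD (contDiff_pd (hW i) i) x, inner_sum, Finset.mul_sum]
  rw [hlhs, Finset.sum_congr rfl fun i _ => hdiv i, Finset.sum_sub_distrib,
    Finset.sum_add_distrib, hrem, ← Finset.mul_sum]
  ring


/-- Bochner-type identity (formula (2.6) of the paper) for a smooth solution of the
regularized p-harmonic flow with flat source `ℝ^m` and flat target `ℝ^L`. -/
theorem bochner_identity_flat (m L : ℕ) (hm : 1 ≤ m) (hL : 1 ≤ L)
    (p T ε : ℝ) (hp : 2 ≤ p) (hT : 0 < T) (hε : ε ∈ Ioo (0 : ℝ) 1)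
    (u : ℝ → EuclideanSpace ℝ (Fin m) → EuclideanSpace ℝ (Fin L))
    (hu : ContDiffOn ℝ (⊤ : ℕ∞) (fun q : ℝ × EuclideanSpace ℝ (Fin m) => u q.1 q.2)
      ((Ioo 0 T) ×ˢ (univ : Set (EuclideanSpace ℝ (Fin m)))))
    (F : ℝ → EuclideanSpace ℝ (Fin m) → ℝ)
    (hF : ∀ t x, F t x = ε + ∑ i, ‖pd (u t) i x‖ ^ 2)
    (hpde : ∀ t ∈ Ioo (0 : ℝ) T, ∀ x, deriv (fun s => u s x) t =
      ∑ i, pd (fun y => (F t y) ^ ((p - 2) / 2) • pd (u t) i y) i x) :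
    ∀ t ∈ Ioo (0 : ℝ) T, ∀ x,
      deriv (fun s => F s x) t
          - (∑ j, pd (fun y => (F t y) ^ ((p - 2) / 2) * pd (F t) j y) j x)
        = (p - 2) * (∑ j, pd (fun y => (F t y) ^ ((p - 4) / 2)
              * ∑ i, ⟪pd (u t) i y, pd (u t) j y⟫ * pd (F t) i y) j x)
          - 2 * (F t x) ^ ((p - 2) / 2)
              * (∑ i, ∑ j, ‖pd (fun y => pd (u t) j y) i x‖ ^ 2)
          - ((p - 2) / 2) * (F t x) ^ ((p - 4) / 2) * (∑ i, (pd (F t) i x) ^ 2) := by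
  intro t ht x
  have hv : ContDiff ℝ (⊤ : ℕ∞) (u t) := contDiff_iff_contDiffAt.2 fun y =>
    (hu.contDiffAt ((isOpen_Ioo.prod isOpen_univ).mem_nhds ⟨ht, mem_univ y⟩)).comp y
      (contDiff_prodMk_right t).contDiffAt
  have hpd := hasDerivAt_pd isOpen_Ioo hu ht x
  have hFt : HasDerivAt (fun s => F s x)
      (∑ k, 2 * ⟪pd (u t) k x, pd (fun y => deriv (fun s => u s y) t) k x⟫) t := by
    rw [funext fun s => hF s x]
    exact (HasDerivAt.fun_sum fun k _ => (hpd k).norm_sq).const_add ε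
  rw [hFt.deriv, funext (hpde t ht)]
  exact bochner_identity_fixed_time p ε hε.1 hv (hF t) x
end

section
/- Let m, L ≥ 1 be natural numbers and p ≥ 2 a real number. Let u : ℝ^m → ℝ^L be a C¹ map which is weakly p-harmonic, i.e. for every compactly supported smooth map V : ℝ^m → ℝ^L one has ∫_{ℝ^m} |∇u|^{p−2} Σ_{i=1}^m ⟨∂_i u, ∂_i V⟩ dx = 0, where |∇u|² = Σ_{i=1}^m ‖∂_i u‖². If u has finite p-energy, i.e. ∫_{ℝ^m} |∇u|^p dx < ∞, then u is constant. -/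
open scoped RealInnerProductSpace
open MeasureTheory

/-- The gradient of a map on `ℝ^m`, as the family of its partial derivatives with the
Hilbert–Schmidt inner product. -/
noncomputable def grad {m : ℕ} {G : Type*} [NormedAddCommGroup G] [NormedSpace ℝ G]
    (v : EuclideanSpace ℝ (Fin m) → G) (x : EuclideanSpace ℝ (Fin m)) :
    PiLp 2 (fun _ : Fin m => G) :=
  WithLp.toLp 2 fun i => pd v i x

/-- A field of gradients is weakly divergence free if it is `L²`-orthogonal to the gradients of
all compactly supported smooth maps. -/
def WeaklyDivFree {m : ℕ} {G : Type*} [NormedAddCommGroup G] [InnerProductSpace ℝ G]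
    (F : EuclideanSpace ℝ (Fin m) → PiLp 2 (fun _ : Fin m => G)) : Prop :=
  ∀ V : EuclideanSpace ℝ (Fin m) → G, ContDiff ℝ (⊤ : ℕ∞) V → HasCompactSupport V →
    ∫ x, ⟪F x, grad V x⟫ = 0

section Gradient

variable {m : ℕ} {G : Type*} [NormedAddCommGroup G] [InnerProductSpace ℝ G]

theorem continuous_pd {v : EuclideanSpace ℝ (Fin m) → G} (hv : ContDiff ℝ 1 v) (i : Fin m) :
    Continuous (pd v i) :=
  (hv.continuous_fderiv one_ne_zero).clm_apply continuous_const

theorem continuous_grad {v : EuclideanSpace ℝ (Fin m) → G} (hv : ContDiff ℝ 1 v) :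
    Continuous (grad v) :=
  (PiLp.continuous_toLp 2 _).comp (continuous_pi fun i => continuous_pd hv i)

theorem grad_eq_zero_of_notMem_tsupport {v : EuclideanSpace ℝ (Fin m) → G}
    {x : EuclideanSpace ℝ (Fin m)} (hx : x ∉ tsupport v) : grad v x = 0 := by
  ext i
  simp [grad, pd, fderiv_of_notMem_tsupport ℝ hx]

theorem hasCompactSupport_grad {v : EuclideanSpace ℝ (Fin m) → G} (hv : HasCompactSupport v) :
    HasCompactSupport (grad v) :=
  HasCompactSupport.intro hv fun _ => grad_eq_zero_of_notMem_tsupport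

theorem grad_sub {v w : EuclideanSpace ℝ (Fin m) → G} (hv : ContDiff ℝ 1 v)
    (hw : ContDiff ℝ 1 w) (x : EuclideanSpace ℝ (Fin m)) :
    grad (fun y => v y - w y) x = grad v x - grad w x := by
  ext i
  simp [grad, pd, fderiv_fun_sub (hv.differentiable one_ne_zero x)
    (hw.differentiable one_ne_zero x)]

theorem grad_comp_add_right (v : EuclideanSpace ℝ (Fin m) → G)
    (h x : EuclideanSpace ℝ (Fin m)) : grad (fun y => v (y + h)) x = grad v (x + h) := by
  ext i
  simp [grad, pd, fderiv_comp_add_right]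

theorem abs_inner_le_norm_mul_sum (ξ η : PiLp 2 (fun _ : Fin m => G)) :
    |⟪ξ, η⟫| ≤ ‖ξ‖ * ∑ i, ‖η i‖ := by
  rw [PiLp.inner_apply, Finset.mul_sum]
  refine (Finset.abs_sum_le_sum_abs _ _).trans (Finset.sum_le_sum fun i _ => ?_)
  exact (abs_real_inner_le_norm _ _).trans
    (mul_le_mul_of_nonneg_right (PiLp.norm_apply_le ξ i) (norm_nonneg _))

theorem norm_fderiv_apply_le (v : EuclideanSpace ℝ (Fin m) → G)
    (x h : EuclideanSpace ℝ (Fin m)) :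
    ‖fderiv ℝ v x h‖ ≤ (∑ i, |h i|) * ‖grad v x‖ := by
  have hsum : h = ∑ i, h i • EuclideanSpace.single i (1 : ℝ) := by
    ext j
    simp [Pi.single_apply]
  conv_lhs => rw [hsum, map_sum]
  rw [Finset.sum_mul]
  refine norm_sum_le_of_le _ fun i _ => ?_
  rw [map_smul, norm_smul, Real.norm_eq_abs]
  exact mul_le_mul_of_nonneg_left (PiLp.norm_apply_le (grad v x) i) (abs_nonneg _)

open scoped Convolution in
/-- A compactly supported `C¹` map can be approximated by smooth maps supported in a fixed
compact set, with uniformly close partial derivatives. -/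
theorem exists_contDiff_pd_approx [FiniteDimensional ℝ G] {V : EuclideanSpace ℝ (Fin m) → G}
    (hV : ContDiff ℝ 1 V) (hc : HasCompactSupport V) {ε : ℝ} (hε : 0 < ε) :
    ∃ W : EuclideanSpace ℝ (Fin m) → G, ContDiff ℝ (⊤ : ℕ∞) W ∧
      tsupport W ⊆ Metric.cthickening 1 (tsupport V) ∧ ∀ i x, ‖pd W i x - pd V i x‖ ≤ ε := by
  have huc : UniformContinuous (fderiv ℝ V) :=
    (hV.continuous_fderiv one_ne_zero).uniformContinuous_of_tendsto_cocompact
      (hc.fderiv ℝ).is_zero_at_infty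
  obtain ⟨δ, hδ, hδε⟩ := Metric.uniformContinuous_iff.1 huc ε hε
  have hr : 0 < min δ 1 := lt_min hδ one_pos
  let φ : ContDiffBump (0 : EuclideanSpace ℝ (Fin m)) := ⟨min δ 1 / 2, min δ 1, by positivity,
    by linarith⟩
  have hφ : LocallyIntegrable (φ.normed volume) volume :=
    φ.continuous_normed.locallyIntegrable
  refine ⟨φ.normed volume ⋆[ContinuousLinearMap.lsmul ℝ ℝ] V, ?_, ?_, fun i x => ?_⟩
  · exact φ.hasCompactSupport_normed.contDiff_convolution_left _ φ.contDiff_normed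
      hV.continuous.locallyIntegrable
  · refine closure_minimal ?_ Metric.isClosed_cthickening
    refine (support_convolution_subset _).trans ?_
    rintro _ ⟨a, ha, b, hb, rfl⟩
    rw [φ.support_normed_eq, mem_ball_zero_iff] at ha
    refine Metric.mem_cthickening_of_dist_le _ b _ _ (subset_tsupport _ hb) ?_
    rw [dist_eq_norm, add_sub_cancel_right]
    exact ha.le.trans (min_le_right _ _)
  · have hd := hc.hasFDerivAt_convolution_right (ContinuousLinearMap.lsmul ℝ ℝ) hφ hV x
    rw [pd, hd.fderiv, convolution_precompR_apply _ hφ (hc.fderiv ℝ)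
      (hV.continuous_fderiv one_ne_zero), ← dist_eq_norm]
    refine φ.dist_normed_convolution_le (continuous_pd hV i).aestronglyMeasurable fun y hy => ?_
    have hy' : dist y x < δ := (Metric.mem_ball.1 hy).trans_le (min_le_left _ _)
    rw [dist_eq_norm, ← sub_apply]
    refine (ContinuousLinearMap.le_opNorm _ _).trans ?_
    simpa [← dist_eq_norm] using (hδε hy').le

theorem integrable_inner_grad {F : EuclideanSpace ℝ (Fin m) → PiLp 2 (fun _ : Fin m => G)}
    (hF : Continuous F) {V : EuclideanSpace ℝ (Fin m) → G} (hV : ContDiff ℝ 1 V)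
    (hc : HasCompactSupport V) : Integrable fun x => ⟪F x, grad V x⟫ :=
  (hF.inner (continuous_grad hV)).integrable_of_hasCompactSupport
    ((hasCompactSupport_grad hc).mono fun x hx h0 => hx (by simp [h0]))

theorem WeaklyDivFree.integral_eq_zero [FiniteDimensional ℝ G]
    {F : EuclideanSpace ℝ (Fin m) → PiLp 2 (fun _ : Fin m => G)} (hF : WeaklyDivFree F)
    (hFc : Continuous F) {V : EuclideanSpace ℝ (Fin m) → G} (hV : ContDiff ℝ 1 V)
    (hc : HasCompactSupport V) : ∫ x, ⟪F x, grad V x⟫ = 0 := by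
  set K := Metric.cthickening 1 (tsupport V)
  have hKc : IsCompact K := hc.isCompact.cthickening
  have key : ∀ ε > 0, |∫ x, ⟪F x, grad V x⟫| ≤ ((∫ x in K, ‖F x‖) * m) * ε := by
    intro ε hε
    obtain ⟨W, hW, hWK, hWV⟩ := exists_contDiff_pd_approx hV hc hε
    have hWc : HasCompactSupport W := hKc.of_isClosed_subset (isClosed_tsupport W) hWK
    have hW1 : ContDiff ℝ 1 W := hW.of_le (by exact_mod_cast le_top)
    have h1 : ∫ x, ⟪F x, grad V x⟫ = -∫ x in K, ⟪F x, grad W x - grad V x⟫ := by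
      rw [setIntegral_eq_integral_of_forall_compl_eq_zero]
      · simp only [inner_sub_right]
        rw [integral_sub (integrable_inner_grad hFc hW1 hWc)
          (integrable_inner_grad hFc hV hc), hF W hW hWc]
        ring
      · intro x hx
        rw [grad_eq_zero_of_notMem_tsupport fun h => hx (hWK h),
          grad_eq_zero_of_notMem_tsupport fun h => hx (Metric.self_subset_cthickening _ h)]
        simp
    rw [h1, abs_neg, mul_assoc, ← integral_mul_const]
    refine norm_integral_le_of_norm_le (f := fun x => ⟪F x, grad W x - grad V x⟫)
      ((hFc.norm.continuousOn.integrableOn_compact hKc).mul_const _) (ae_of_all _ fun x => ?_)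
    refine (abs_inner_le_norm_mul_sum _ _).trans
      (mul_le_mul_of_nonneg_left ?_ (norm_nonneg _))
    calc ∑ i, ‖(grad W x - grad V x) i‖ ≤ ∑ _i : Fin m, ε :=
          Finset.sum_le_sum fun i _ => hWV i x
      _ = m * ε := by simp
  have hlim : Filter.Tendsto (fun ε : ℝ => ((∫ x in K, ‖F x‖) * m) * ε)
      (nhdsWithin 0 (Set.Ioi 0)) (nhds 0) :=
    Filter.Tendsto.mono_left (by simpa using
      (continuous_const_mul ((∫ x in K, ‖F x‖) * m)).tendsto (0 : ℝ)) nhdsWithin_le_nhds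
  refine abs_nonpos_iff.1 (ge_of_tendsto hlim ?_)
  filter_upwards [self_mem_nhdsWithin] with ε hε using key ε hε

theorem WeaklyDivFree.comp_add_right
    {F : EuclideanSpace ℝ (Fin m) → PiLp 2 (fun _ : Fin m => G)} (hF : WeaklyDivFree F)
    (h : EuclideanSpace ℝ (Fin m)) : WeaklyDivFree fun x => F (x + h) := by
  intro V hV hc
  have hV' : ContDiff ℝ (⊤ : ℕ∞) fun x => V (x + -h) := hV.comp (contDiff_id.add contDiff_const)
  have := hF _ hV' (hc.comp_homeomorph (Homeomorph.addRight (-h)))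
  simp only [grad_comp_add_right] at this
  rw [← integral_add_right_eq_self _ h] at this
  simpa using this

theorem WeaklyDivFree.sub {F F' : EuclideanSpace ℝ (Fin m) → PiLp 2 (fun _ : Fin m => G)}
    (hF : WeaklyDivFree F) (hF' : WeaklyDivFree F') (hFc : Continuous F)
    (hFc' : Continuous F') : WeaklyDivFree fun x => F x - F' x := by
  intro V hV hc
  have hV1 : ContDiff ℝ 1 V := hV.of_le (by exact_mod_cast le_top)
  simp only [inner_sub_left]
  rw [integral_sub (integrable_inner_grad hFc hV1 hc) (integrable_inner_grad hFc' hV1 hc),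
    hF V hV hc, hF' V hV hc, sub_zero]

end Gradient

section Translation

variable {m : ℕ} {G : Type*} [NormedAddCommGroup G] [InnerProductSpace ℝ G]

theorem rpow_norm_translate_sub_le [CompleteSpace G] {p : ℝ} (hp : 1 ≤ p)
    {u : EuclideanSpace ℝ (Fin m) → G} (hu : ContDiff ℝ 1 u) (h x : EuclideanSpace ℝ (Fin m)) :
    ‖u (x + h) - u x‖ ^ p ≤
      ∫ t in Set.Ioc (0 : ℝ) 1, ((∑ i, |h i|) * ‖grad u (x + t • h)‖) ^ p := by
  have hline : Continuous fun t : ℝ => x + t • h := by fun_prop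
  have hderiv : ∀ t : ℝ, HasDerivAt (fun t : ℝ => u (x + t • h))
      (fderiv ℝ u (x + t • h) h) t := fun t =>
    (hu.differentiable one_ne_zero _).hasFDerivAt.comp_hasDerivAt t
      (by simpa using ((hasDerivAt_id t).smul_const h).const_add x)
  have hcont : Continuous fun t : ℝ => fderiv ℝ u (x + t • h) h :=
    ((hu.continuous_fderiv one_ne_zero).comp hline).clm_apply continuous_const
  have hftc : ∫ t in Set.Ioc (0 : ℝ) 1, fderiv ℝ u (x + t • h) h = u (x + h) - u x := by
    rw [← intervalIntegral.integral_of_le zero_le_one,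
      intervalIntegral.integral_eq_sub_of_hasDerivAt (fun t _ => hderiv t)
        (hcont.intervalIntegrable _ _)]
    simp
  have : IsProbabilityMeasure (volume.restrict (Set.Ioc (0 : ℝ) 1)) := ⟨by simp⟩
  have hg : Continuous fun t : ℝ => (∑ i, |h i|) * ‖grad u (x + t • h)‖ :=
    continuous_const.mul ((continuous_grad hu).comp hline).norm
  have hg0 : ∀ t : ℝ, 0 ≤ (∑ i, |h i|) * ‖grad u (x + t • h)‖ := fun t => by positivity
  have hgi := hg.integrableOn_Ioc (μ := volume) (a := 0) (b := 1)
  rw [← hftc]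
  calc _ ≤ (∫ t in Set.Ioc (0 : ℝ) 1, (∑ i, |h i|) * ‖grad u (x + t • h)‖) ^ p := by
        refine Real.rpow_le_rpow (norm_nonneg _) ?_ (by linarith)
        exact norm_integral_le_of_norm_le hgi (ae_of_all _ fun t => norm_fderiv_apply_le u _ h)
    _ ≤ _ := (convexOn_rpow hp).map_integral_le
        (Real.continuous_rpow_const (by linarith)).continuousOn isClosed_Ici
        (ae_of_all _ hg0) hgi
        (hg.rpow_const fun _ => Or.inr (by linarith)).integrableOn_Ioc

theorem integrable_rpow_norm_translate_sub [CompleteSpace G] {p : ℝ} (hp : 1 ≤ p)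
    {u : EuclideanSpace ℝ (Fin m) → G} (hu : ContDiff ℝ 1 u)
    (henergy : Integrable fun x => ‖grad u x‖ ^ p) (h : EuclideanSpace ℝ (Fin m)) :
    Integrable fun x => ‖u (x + h) - u x‖ ^ p := by
  have hp0 : 0 ≤ p := by linarith
  have hu0 := hu.continuous
  have hcont : Continuous fun z : EuclideanSpace ℝ (Fin m) × ℝ =>
      ((∑ i, |h i|) * ‖grad u (z.1 + z.2 • h)‖) ^ p :=
    (continuous_const.mul ((continuous_grad hu).comp (by fun_prop)).norm).rpow_const
      fun _ => Or.inr hp0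
  have hprod : Integrable (fun z : EuclideanSpace ℝ (Fin m) × ℝ =>
      ((∑ i, |h i|) * ‖grad u (z.1 + z.2 • h)‖) ^ p)
      (volume.prod (volume.restrict (Set.Ioc (0 : ℝ) 1))) := by
    have heq : ∀ (x : EuclideanSpace ℝ (Fin m)) (t : ℝ),
        ((∑ i, |h i|) * ‖grad u (x + t • h)‖) ^ p =
          (∑ i, |h i|) ^ p * ‖grad u (x + t • h)‖ ^ p := fun x t =>
      Real.mul_rpow (by positivity) (norm_nonneg _)
    rw [integrable_prod_iff' hcont.aestronglyMeasurable]
    constructor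
    · refine ae_of_all _ fun t => ?_
      simp only [heq]
      exact (henergy.comp_add_right (t • h)).const_mul _
    · have hconst : ∀ t : ℝ, ∫ x, ‖((∑ i, |h i|) * ‖grad u (x + t • h)‖) ^ p‖ =
          ∫ x, ‖(∑ i, |h i|) ^ p * ‖grad u x‖ ^ p‖ := fun t => by
        simp only [heq]
        exact integral_add_right_eq_self (fun x => ‖(∑ i, |h i|) ^ p * ‖grad u x‖ ^ p‖) (t • h)
      simp only [hconst]
      exact integrable_const _
  refine hprod.integral_prod_left.mono' (Continuous.aestronglyMeasurable
    (((hu0.comp (by fun_prop)).sub hu0).norm.rpow_const fun _ => Or.inr hp0))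
    (ae_of_all _ fun x => ?_)
  rw [Real.norm_of_nonneg (by positivity)]
  exact rpow_norm_translate_sub_le hp hu h x

end Translation

section PowerField

variable {H : Type*} [NormedAddCommGroup H] [InnerProductSpace ℝ H]

/-- The field `|ξ|^q ξ` underlying the `(q + 2)`-Laplacian. -/
noncomputable def powerField (q : ℝ) (ξ : H) : H := ‖ξ‖ ^ q • ξ

theorem continuous_powerField {q : ℝ} (hq : 0 ≤ q) : Continuous (powerField q : H → H) :=
  (continuous_norm.rpow_const fun _ => Or.inr hq).smul continuous_id

theorem inner_powerField_sub_powerField (q : ℝ) (a b : H) :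
    ⟪powerField q a - powerField q b, a - b⟫ =
      ((‖a‖ ^ q + ‖b‖ ^ q) * ‖a - b‖ ^ 2 + (‖a‖ ^ q - ‖b‖ ^ q) * (‖a‖ ^ 2 - ‖b‖ ^ 2)) / 2 := by
  rw [norm_sub_sq_real]
  simp only [powerField, inner_sub_left, inner_sub_right, real_inner_smul_left,
    real_inner_self_eq_norm_sq, real_inner_comm a b]
  ring

theorem le_inner_powerField_sub_powerField {q : ℝ} (hq : 0 ≤ q) (a b : H) :
    (‖a‖ ^ q + ‖b‖ ^ q) * ‖a - b‖ ^ 2 / 2 ≤ ⟪powerField q a - powerField q b, a - b⟫ := by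
  have h : 0 ≤ (‖a‖ ^ q - ‖b‖ ^ q) * (‖a‖ ^ 2 - ‖b‖ ^ 2) := by
    rcases le_total ‖a‖ ‖b‖ with hab | hab
    · exact mul_nonneg_of_nonpos_of_nonpos
        (sub_nonpos.2 (Real.rpow_le_rpow (norm_nonneg _) hab hq))
        (sub_nonpos.2 (pow_le_pow_left₀ (norm_nonneg _) hab 2))
    · exact mul_nonneg
        (sub_nonneg.2 (Real.rpow_le_rpow (norm_nonneg _) hab hq))
        (sub_nonneg.2 (pow_le_pow_left₀ (norm_nonneg _) hab 2))
  rw [inner_powerField_sub_powerField]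
  linarith

theorem inner_powerField_sub_powerField_nonneg {q : ℝ} (hq : 0 ≤ q) (a b : H) :
    0 ≤ ⟪powerField q a - powerField q b, a - b⟫ :=
  le_trans (by positivity) (le_inner_powerField_sub_powerField hq a b)

theorem eq_of_inner_powerField_sub_powerField_eq_zero {q : ℝ} (hq : 0 ≤ q) {a b : H}
    (h : ⟪powerField q a - powerField q b, a - b⟫ = 0) : a = b := by
  have hle := le_inner_powerField_sub_powerField hq a b
  by_contra hab
  have hpos : 0 < ‖a - b‖ := norm_pos_iff.2 (sub_ne_zero.2 hab)
  have hsum : 0 < ‖a‖ ^ q + ‖b‖ ^ q := by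
    rcases eq_or_ne a 0 with rfl | ha
    · have hb : 0 < ‖b‖ := norm_pos_iff.2 fun hb => hab hb.symm
      positivity
    · have ha' : 0 < ‖a‖ := norm_pos_iff.2 ha
      positivity
  have : 0 < (‖a‖ ^ q + ‖b‖ ^ q) * ‖a - b‖ ^ 2 / 2 := by positivity
  linarith

theorem norm_powerField_mul_le {q : ℝ} (hq : 0 ≤ q) (ξ : H) {b : ℝ} (hb : 0 ≤ b) :
    ‖powerField q ξ‖ * b ≤ ‖ξ‖ ^ (q + 2) + b ^ (q + 2) := by
  have hbound : ∀ s t : ℝ, 0 ≤ s → 0 ≤ t → s ^ (q + 2) + t ^ (q + 2) ≥ (max s t) ^ (q + 2) := by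
    intro s t hs ht
    have := Real.rpow_nonneg hs (q + 2)
    have := Real.rpow_nonneg ht (q + 2)
    rcases max_choice s t with h | h <;> rw [h] <;> linarith
  refine le_trans ?_ (hbound ‖ξ‖ b (norm_nonneg _) hb)
  have hM : 0 ≤ max ‖ξ‖ b := le_max_of_le_right hb
  rw [powerField, norm_smul, Real.norm_of_nonneg (by positivity),
    Real.rpow_add' hM (by linarith), Real.rpow_two, pow_two, mul_assoc]
  exact mul_le_mul (Real.rpow_le_rpow (norm_nonneg _) (le_max_left _ _) hq)
    (mul_le_mul (le_max_left _ _) (le_max_right _ _) hb hM) (by positivity) (by positivity)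

end PowerField

section Cutoff

variable {m : ℕ} {G : Type*} [NormedAddCommGroup G] [InnerProductSpace ℝ G]

theorem exists_cutoff (m : ℕ) : ∃ C : ℝ, ∀ R > 0, ∃ φ : EuclideanSpace ℝ (Fin m) → ℝ,
    ContDiff ℝ 1 φ ∧ HasCompactSupport φ ∧ (∀ x, 0 ≤ φ x ∧ φ x ≤ 1) ∧
      (∀ x, ‖x‖ ≤ R → φ x = 1) ∧ (∀ x, 2 * R ≤ ‖x‖ → φ x = 0) ∧
      ∀ i x, |pd φ i x| ≤ C / R := by
  let f : ContDiffBump (0 : EuclideanSpace ℝ (Fin m)) := ⟨1, 2, one_pos, one_lt_two⟩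
  have hf : ContDiff ℝ 1 f := f.contDiff
  obtain ⟨C, hC⟩ := (f.hasCompactSupport.fderiv ℝ).exists_bound_of_continuous
    (hf.continuous_fderiv one_ne_zero)
  refine ⟨C, fun R hR => ⟨fun x => f (R⁻¹ • x), hf.comp (contDiff_const_smul _),
    f.hasCompactSupport.comp_homeomorph (Homeomorph.smulOfNeZero R⁻¹ (inv_ne_zero hR.ne')),
    fun x => ⟨f.nonneg, f.le_one⟩, fun x hx => ?_, fun x hx => ?_, fun i x => ?_⟩⟩
  · refine f.one_of_mem_closedBall ?_
    rw [mem_closedBall_zero_iff, norm_smul, norm_inv, Real.norm_of_nonneg hR.le]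
    exact inv_mul_le_one_of_le₀ hx hR.le
  · refine f.zero_of_le_dist ?_
    rw [dist_zero_right, norm_smul, norm_inv, Real.norm_of_nonneg hR.le, inv_mul_eq_div,
      le_div_iff₀ hR]
    exact hx
  · have hd : HasFDerivAt (fun x => f (R⁻¹ • x))
        ((fderiv ℝ f (R⁻¹ • x)).comp (R⁻¹ • ContinuousLinearMap.id ℝ _)) x :=
      (hf.differentiable one_ne_zero _).hasFDerivAt.comp x ((hasFDerivAt_id x).const_smul R⁻¹)
    have hle := (fderiv ℝ f (R⁻¹ • x)).le_opNorm (EuclideanSpace.single i 1)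
    rw [PiLp.norm_single, norm_one, mul_one] at hle
    rw [pd, hd.fderiv]
    simp only [ContinuousLinearMap.comp_apply, smul_apply,
      ContinuousLinearMap.id_apply, map_smul, smul_eq_mul, abs_mul, abs_inv, abs_of_pos hR]
    rw [inv_mul_eq_div]
    exact div_le_div_of_nonneg_right (hle.trans (hC _)) hR.le

theorem grad_smul {φ : EuclideanSpace ℝ (Fin m) → ℝ} {w : EuclideanSpace ℝ (Fin m) → G}
    (hφ : ContDiff ℝ 1 φ) (hw : ContDiff ℝ 1 w) (x : EuclideanSpace ℝ (Fin m)) :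
    grad (fun y => φ y • w y) x =
      φ x • grad w x + WithLp.toLp 2 fun i => pd φ i x • w x := by
  ext i
  simp [grad, pd, fderiv_fun_smul (hφ.differentiable one_ne_zero x)
    (hw.differentiable one_ne_zero x)]

theorem WeaklyDivFree.inner_grad_eq_zero [FiniteDimensional ℝ G]
    {F : EuclideanSpace ℝ (Fin m) → PiLp 2 (fun _ : Fin m => G)}
    (hF : WeaklyDivFree F) (hFc : Continuous F) {w : EuclideanSpace ℝ (Fin m) → G} (hw : ContDiff ℝ 1 w)
    (hnonneg : ∀ x, 0 ≤ ⟪F x, grad w x⟫) (hint : Integrable fun x => ‖F x‖ * ‖w x‖)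
    (x : EuclideanSpace ℝ (Fin m)) : ⟪F x, grad w x⟫ = 0 := by
  obtain ⟨C, hC⟩ := exists_cutoff m
  have hP : Continuous fun x => ⟪F x, grad w x⟫ := hFc.inner (continuous_grad hw)
  have hcutint : ∀ φ : EuclideanSpace ℝ (Fin m) → ℝ, Continuous φ → HasCompactSupport φ →
      Integrable fun x => φ x * ⟪F x, grad w x⟫ := fun φ hφ hφc =>
    (hφ.mul hP).integrable_of_hasCompactSupport hφc.mul_right
  have key : ∀ R > 0, ∀ φ : EuclideanSpace ℝ (Fin m) → ℝ, ContDiff ℝ 1 φ →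
      HasCompactSupport φ → (∀ i x, |pd φ i x| ≤ C / R) →
      ∫ x, φ x * ⟪F x, grad w x⟫ ≤ (∫ x, ‖F x‖ * ‖w x‖) * (m * (C / R)) := by
    intro R hR φ hφ hφc hφC
    have hzero := hF.integral_eq_zero hFc (V := fun y => φ y • w y) (hφ.smul hw) hφc.smul_right
    have hpt : ∀ x, φ x * ⟪F x, grad w x⟫ = ⟪F x, grad (fun y => φ y • w y) x⟫ +
        -⟪F x, WithLp.toLp 2 fun i => pd φ i x • w x⟫ := fun x => by
      rw [grad_smul hφ hw, inner_add_right, real_inner_smul_right]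
      ring
    have hVint : Integrable fun x => ⟪F x, grad (fun y => φ y • w y) x⟫ :=
      integrable_inner_grad hFc (hφ.smul hw) hφc.smul_right
    have hle : ∀ x, φ x * ⟪F x, grad w x⟫ ≤ ⟪F x, grad (fun y => φ y • w y) x⟫ +
        ‖F x‖ * ‖w x‖ * (m * (C / R)) := fun x => by
      rw [hpt x]
      refine add_le_add_right ((neg_le_abs _).trans ((abs_inner_le_norm_mul_sum _ _).trans ?_)) _
      rw [mul_assoc]
      refine mul_le_mul_of_nonneg_left ?_ (norm_nonneg _)
      calc ∑ i, ‖pd φ i x • w x‖ ≤ ∑ _i : Fin m, ‖w x‖ * (C / R) :=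
            Finset.sum_le_sum fun i _ => by
              rw [norm_smul, mul_comm]
              exact mul_le_mul_of_nonneg_left (hφC i x) (norm_nonneg _)
        _ = ‖w x‖ * (m * (C / R)) := by
              rw [Finset.sum_const, Finset.card_univ, Fintype.card_fin, nsmul_eq_mul]
              ring
    have := integral_mono (hcutint φ hφ.continuous hφc) (hVint.add (hint.mul_const _)) hle
    simp only [Pi.add_apply] at this
    rwa [integral_add hVint (hint.mul_const _), hzero, zero_add, integral_mul_const] at this
  have hr : 0 < ‖x‖ + 1 := by positivity
  obtain ⟨ψ, hψ, hψc, hψ01, hψ1, hψ0, -⟩ := hC (‖x‖ + 1) hr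
  have hψP : ∀ y, 0 ≤ ψ y * ⟪F y, grad w y⟫ := fun y => mul_nonneg (hψ01 y).1 (hnonneg y)
  have hlim : Filter.Tendsto (fun R : ℝ => (∫ x, ‖F x‖ * ‖w x‖) * (m * (C / R)))
      Filter.atTop (nhds 0) := by
    simpa using ((Filter.tendsto_id.const_div_atTop C).const_mul (m : ℝ)).const_mul
      (∫ x, ‖F x‖ * ‖w x‖)
  have hψint : ∫ y, ψ y * ⟪F y, grad w y⟫ = 0 := by
    refine le_antisymm (ge_of_tendsto hlim ?_) (integral_nonneg hψP)
    filter_upwards [Filter.eventually_ge_atTop (2 * (‖x‖ + 1))] with R hR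
    have hR0 : 0 < R := by linarith
    obtain ⟨φ, hφ, hφc, hφ01, hφ1, -, hφC⟩ := hC R hR0
    refine le_trans (integral_mono (hcutint ψ hψ.continuous hψc) (hcutint φ hφ.continuous hφc)
      fun y => mul_le_mul_of_nonneg_right ?_ (hnonneg y)) (key R hR0 φ hφ hφc hφC)
    rcases le_total ‖y‖ (2 * (‖x‖ + 1)) with hy | hy
    · rw [hφ1 y (hy.trans hR)]
      exact (hψ01 y).2
    · rw [hψ0 y hy]
      exact (hφ01 y).1
  have hae := (integral_eq_zero_iff_of_nonneg hψP (hcutint ψ hψ.continuous hψc)).1 hψint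
  have hall := congrFun ((hψ.continuous.mul hP).ae_eq_iff_eq volume continuous_zero |>.1 hae) x
  simpa [hψ1 x (by linarith)] using hall

end Cutoff

theorem grad_translate_eq {m : ℕ} {G : Type*} [NormedAddCommGroup G] [InnerProductSpace ℝ G]
    [FiniteDimensional ℝ G] {q : ℝ} (hq : 0 ≤ q) {u : EuclideanSpace ℝ (Fin m) → G}
    (hu : ContDiff ℝ 1 u) (hweak : WeaklyDivFree fun x => powerField q (grad u x))
    (henergy : Integrable fun x => ‖grad u x‖ ^ (q + 2)) (x h : EuclideanSpace ℝ (Fin m)) :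
    grad u (x + h) = grad u x := by
  have hF : Continuous fun x => powerField q (grad u x) :=
    (continuous_powerField hq).comp (continuous_grad hu)
  have hFh : Continuous fun x => powerField q (grad u (x + h)) :=
    hF.comp (continuous_add_const h)
  have huh : ContDiff ℝ 1 fun x => u (x + h) := hu.comp (contDiff_id.add contDiff_const)
  have hw : ContDiff ℝ 1 fun x => u (x + h) - u x := huh.sub hu
  have hgrad : ∀ x, grad (fun x => u (x + h) - u x) x = grad u (x + h) - grad u x := fun x => by
    rw [grad_sub huh hu, grad_comp_add_right]
  have hintw := integrable_rpow_norm_translate_sub (by linarith) hu henergy h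
  refine eq_of_inner_powerField_sub_powerField_eq_zero hq ?_
  rw [← hgrad]
  refine WeaklyDivFree.inner_grad_eq_zero
    (F := fun x => powerField q (grad u (x + h)) - powerField q (grad u x))
    ((hweak.comp_add_right h).sub hweak hFh hF) (hFh.sub hF) hw (fun y => ?_) ?_ x
  · rw [hgrad]
    exact inner_powerField_sub_powerField_nonneg hq _ _
  · refine (((henergy.comp_add_right h).add hintw).add (henergy.add hintw)).mono'
      ((hFh.sub hF).norm.mul hw.continuous.norm).aestronglyMeasurable (ae_of_all _ fun y => ?_)
    rw [Real.norm_of_nonneg (by positivity)]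
    refine (mul_le_mul_of_nonneg_right (norm_sub_le _ _) (norm_nonneg _)).trans ?_
    rw [add_mul]
    exact add_le_add (norm_powerField_mul_le hq _ (norm_nonneg _))
      (norm_powerField_mul_le hq _ (norm_nonneg _))

/-- Liouville theorem (Theorem 1.4 of the paper, flat case): a C¹ weakly p-harmonic
map `u : ℝ^m → ℝ^L` with finite p-energy is constant. -/
theorem liouville_p_harmonic_flat (m L : ℕ) (hm : 1 ≤ m) (hL : 1 ≤ L)
    (p : ℝ) (hp : 2 ≤ p)
    (u : EuclideanSpace ℝ (Fin m) → EuclideanSpace ℝ (Fin L))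
    (hu : ContDiff ℝ 1 u)
    (hweak : ∀ V : EuclideanSpace ℝ (Fin m) → EuclideanSpace ℝ (Fin L),
      ContDiff ℝ (⊤ : ℕ∞) V → HasCompactSupport V →
      (∫ x, (∑ i, ‖pd u i x‖ ^ 2) ^ ((p - 2) / 2) * ∑ i, ⟪pd u i x, pd V i x⟫) = 0)
    (henergy : Integrable (fun x => (∑ i, ‖pd u i x‖ ^ 2) ^ (p / 2))) :
    ∃ c, ∀ x, u x = c := by
  have hnorm : ∀ (r : ℝ) x, (∑ i, ‖pd u i x‖ ^ 2) ^ (r / 2) = ‖grad u x‖ ^ r := fun r x => by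
    have hsq : ∑ i, ‖pd u i x‖ ^ 2 = ‖grad u x‖ ^ 2 := (PiLp.norm_sq_eq_of_L2 _ (grad u x)).symm
    rw [hsq, ← Real.rpow_two, ← Real.rpow_mul (norm_nonneg _), mul_div_cancel₀ r two_ne_zero]
  simp only [hnorm] at hweak henergy
  have hdiv : WeaklyDivFree fun x => powerField (p - 2) (grad u x) := fun V hV hc => by
    simp only [powerField, real_inner_smul_left, PiLp.inner_apply (grad u _)]
    exact hweak V hV hc
  have hconst : ∀ x, grad u x = grad u 0 := fun x => by
    simpa using grad_translate_eq (sub_nonneg.2 hp) hu hdiv (by simpa using henergy) 0 x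
  have : Nonempty (Fin m) := ⟨⟨0, hm⟩⟩
  have hinf : ¬ IsFiniteMeasure (volume : Measure (EuclideanSpace ℝ (Fin m))) := fun hfin =>
    (measure_lt_top (volume : Measure (EuclideanSpace ℝ (Fin m))) Set.univ).ne
      (measure_univ_of_isAddLeftInvariant _)
  have hint : Integrable fun _ : EuclideanSpace ℝ (Fin m) => ‖grad u 0‖ ^ p :=
    henergy.congr (ae_of_all _ fun x => congrArg (‖·‖ ^ p) (hconst x))
  have hpow := (integrable_const_iff.1 hint).resolve_right hinf
  have hzero : grad u 0 = 0 :=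
    norm_eq_zero.1 (((Real.rpow_eq_zero_iff_of_nonneg (norm_nonneg _)).1 hpow).1)
  refine ⟨u 0, fun x => is_const_of_fderiv_eq_zero (𝕜 := ℝ)
    (hu.differentiable one_ne_zero) (fun y => ?_) x 0⟩
  ext1 h
  have := norm_fderiv_apply_le u y h
  rw [hconst, hzero, norm_zero, mul_zero] at this
  simpa using this
end
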